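/- (Lemma 1, Epistemic Uncertainty Upper Bound.) Let W ∈ ℝ^{V×d} be a matrix, let h, h* ∈ ℝ^d, and define the two softmax distributions over the finite index set V by P(i) = exp((W h)_i)/Σ_{j∈V} exp((W h)_j) and P*(i) = exp((W h*)_i)/Σ_{j∈V} exp((W h*)_j). Then KL(P* ‖ P) ≤ 2·‖W‖·‖h* − h‖, where ‖W‖ is the ℓ²→ℓ² operator norm of W and ‖h* − h‖ is the Euclidean norm. -/

import Mathlib

/-- If two families of logits differ by at most `c` in every coordinate, then the KL divergence
between their softmax distributions is at most `2 * c`. -/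
theorem kl_softmax_le_two_mul_of_abs_sub_le {ι : Type*} [Fintype ι] [Nonempty ι]
    {x y : ι → ℝ} {c : ℝ} (hc : ∀ i, |x i - y i| ≤ c) :
    ∑ i, (Real.exp (x i) / ∑ j, Real.exp (x j)) *
        Real.log ((Real.exp (x i) / ∑ j, Real.exp (x j)) /
          (Real.exp (y i) / ∑ j, Real.exp (y j)))
      ≤ 2 * c := by
  have hx : 0 < ∑ j, Real.exp (x j) :=
    Finset.sum_pos (fun j _ => Real.exp_pos _) Finset.univ_nonempty
  have hy : 0 < ∑ j, Real.exp (y j) :=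
    Finset.sum_pos (fun j _ => Real.exp_pos _) Finset.univ_nonempty
  have hlog : Real.log (∑ j, Real.exp (y j)) ≤ c + Real.log (∑ j, Real.exp (x j)) := by
    rw [← Real.log_exp c, ← Real.log_mul (Real.exp_pos c).ne' hx.ne', Finset.mul_sum]
    refine Real.log_le_log hy (Finset.sum_le_sum fun j _ => ?_)
    rw [← Real.exp_add, Real.exp_le_exp]
    linarith [(abs_le.mp (hc j)).1]
  calc
    _ ≤ ∑ i, (Real.exp (x i) / ∑ j, Real.exp (x j)) * (2 * c) := by
      refine Finset.sum_le_sum fun i _ => mul_le_mul_of_nonneg_left ?_ (by positivity)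
      rw [Real.log_div (by positivity) (by positivity), Real.log_div (by positivity) hx.ne',
        Real.log_div (by positivity) hy.ne', Real.log_exp, Real.log_exp]
      linarith [(abs_le.mp (hc i)).2]
    _ = 2 * c := by
      rw [← Finset.sum_mul, ← Finset.sum_div, div_self hx.ne', one_mul]

/-- Lemma 1 (Epistemic Uncertainty Upper Bound): for a linear map `W : ℝ^d → ℝ^V`
(the vocabulary projection matrix) and hidden states `h, hstar ∈ ℝ^d`, the KL divergence
between the softmax distributions of the logits `W hstar` and `W h` is bounded by
`2 * ‖W‖ * ‖hstar - h‖`, where `‖W‖` is the ℓ²→ℓ² operator norm. -/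
theorem kl_softmax_le_two_opNorm_mul_norm_sub
    (V d : ℕ) (hV : 0 < V) (hd : 0 < d)
    (W : EuclideanSpace ℝ (Fin d) →L[ℝ] EuclideanSpace ℝ (Fin V))
    (h hstar : EuclideanSpace ℝ (Fin d)) :
    ∑ i, (Real.exp (W hstar i) / ∑ j, Real.exp (W hstar j)) *
        Real.log ((Real.exp (W hstar i) / ∑ j, Real.exp (W hstar j)) /
          (Real.exp (W h i) / ∑ j, Real.exp (W h j)))
      ≤ 2 * ‖W‖ * ‖hstar - h‖ := by
  have : Nonempty (Fin V) := ⟨⟨0, hV⟩⟩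
  rw [mul_assoc]
  refine kl_softmax_le_two_mul_of_abs_sub_le fun i => ?_
  calc
    |W hstar i - W h i| = ‖W (hstar - h) i‖ := by simp [Real.norm_eq_abs]
    _ ≤ ‖W (hstar - h)‖ := PiLp.norm_apply_le _ i
    _ ≤ ‖W‖ * ‖hstar - h‖ := W.le_opNorm _
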